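/- arXiv:0704.2928 — 3 statements merged into one kernel-verified Lean document; each statement's English description precedes it below -/
import Mathlib

section
/- The Yukawa coupling C(x) = (42 − 14x)/(x³·(1 − 57x − 289x² + x³)) of the mirror family satisfies the first-order equation implied by the Picard–Fuchs operator: 2·a₄(x)·C′(x) + a₃(x)·C(x) = 0 as rational functions. Equivalently, with N(x) = 42 − 14x and M(x) = x³·(1 − 57x − 289x² + x³), one has the polynomial identity 2·x⁴·q₄(x)·(N′(x)·M(x) − N(x)·M′(x)) + x³·(q₃(x) + 6q₄(x))·N(x)·M(x) = 0 in ℚ[x]. -/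
open Polynomial

/-- `q₄(x) = 9 − 519x − 2258x² + 1686x³ − 295x⁴ + x⁵`, the coefficient of `θ⁴` in the
Picard–Fuchs operator. -/
noncomputable def q4 : Polynomial ℚ :=
  C 9 - C 519 * X - C 2258 * X ^ 2 + C 1686 * X ^ 3 - C 295 * X ^ 4 + X ^ 5

/-- `q₃(x) = −1020x − 10064x² + 5256x³ − 608x⁴ + 4x⁵`, the coefficient of `θ³` in the
Picard–Fuchs operator. -/
noncomputable def q3 : Polynomial ℚ :=
  -(C 1020 * X) - C 10064 * X ^ 2 + C 5256 * X ^ 3 - C 608 * X ^ 4 + C 4 * X ^ 5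

/-- `a₄(x) = x⁴·q₄(x)`, the leading coefficient of the Picard–Fuchs operator in derivative
form. -/
noncomputable def a4 : Polynomial ℚ := X ^ 4 * q4

/-- `a₃(x) = x³·(q₃(x) + 6q₄(x))`, the subleading coefficient of the Picard–Fuchs operator in
derivative form. -/
noncomputable def a3 : Polynomial ℚ := X ^ 3 * (q3 + 6 * q4)

/-- `N(x) = 42 − 14x`, the numerator of the Yukawa coupling. -/
noncomputable def Npoly : Polynomial ℚ := C 42 - C 14 * X

/-- `M(x) = x³·(1 − 57x − 289x² + x³)`, the denominator of the Yukawa coupling. -/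
noncomputable def Mpoly : Polynomial ℚ := X ^ 3 * (1 - C 57 * X - C 289 * X ^ 2 + X ^ 3)

theorem yukawa_polynomial_identity :
    2 * (X ^ 4 * q4) * (derivative Npoly * Mpoly - Npoly * derivative Mpoly)
        + X ^ 3 * (q3 + 6 * q4) * Npoly * Mpoly = 0 := by
  simp only [q4, q3, Npoly, Mpoly, derivative_sub, derivative_add, derivative_mul,
    derivative_X, derivative_X_pow, derivative_one, map_ofNat, map_natCast]
  norm_num
  ring

theorem aeval_Npoly (x : ℝ) : aeval x Npoly = 42 - 14 * x := by
  simp [Npoly]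

theorem aeval_Mpoly (x : ℝ) :
    aeval x Mpoly = x ^ 3 * (1 - 57 * x - 289 * x ^ 2 + x ^ 3) := by
  simp [Mpoly]

/-- The Yukawa coupling `C(x) = (42 − 14x)/(x³(1 − 57x − 289x² + x³))` satisfies the
first-order equation `2a₄C′ + a₃C = 0` implied by the Picard–Fuchs operator; equivalently the
polynomial identity `2x⁴q₄(N′M − NM′) + x³(q₃ + 6q₄)NM = 0` holds in `ℚ[x]`. -/
theorem stmt12 :
    (∀ x : ℝ, x ^ 3 * (1 - 57 * x - 289 * x ^ 2 + x ^ 3) ≠ 0 →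
      2 * (Polynomial.aeval x a4) *
          deriv (fun t : ℝ => (42 - 14 * t) / (t ^ 3 * (1 - 57 * t - 289 * t ^ 2 + t ^ 3))) x
        + (Polynomial.aeval x a3) *
          ((42 - 14 * x) / (x ^ 3 * (1 - 57 * x - 289 * x ^ 2 + x ^ 3))) = 0) ∧
    2 * (X ^ 4 * q4) * (derivative Npoly * Mpoly - Npoly * derivative Mpoly)
        + X ^ 3 * (q3 + 6 * q4) * Npoly * Mpoly = 0 := by
  refine ⟨fun x hx => ?_, yukawa_polynomial_identity⟩
  simp only [← aeval_Npoly, ← aeval_Mpoly] at hx ⊢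
  rw [((Npoly.hasDerivAt_aeval x).fun_div (Mpoly.hasDerivAt_aeval x) hx).deriv]
  have h := congrArg (aeval x) yukawa_polynomial_identity
  simp only [← a4.eq_def, ← a3.eq_def, map_add, map_sub, map_mul, map_ofNat, map_zero] at h
  field_simp
  linear_combination h
end

section
/- For every complex number α with 1 − 57α − 289α² + α³ = 0 (a conifold point of the mirror family): a₄(α) = 0, a₄′(α) ≠ 0, and the indicial polynomial of the Picard–Fuchs operator at α, namely I_α(ρ) = a₄′(α)·ρ(ρ−1)(ρ−2)(ρ−3) + a₃(α)·ρ(ρ−1)(ρ−2), satisfies I_α(ρ) = a₄′(α)·ρ(ρ−1)²(ρ−2) as polynomials in ρ (equivalently a₃(α) = 2·a₄′(α)). Hence the local exponents of the Picard–Fuchs operator at each conifold point are 0, 1, 1, 2. -/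
open Polynomial

/-- `q₄` is the discriminant times the square of the apparent singularity factor `x − 3`. -/
theorem q4_eq_discriminant_mul :
    q4 = (1 - 57 * X - 289 * X ^ 2 + X ^ 3) * (X - 3) ^ 2 := by
  simp only [q4, map_ofNat]
  ring

theorem aeval_a4 (α : ℂ) :
    aeval α a4 = α ^ 4 * ((1 - 57 * α - 289 * α ^ 2 + α ^ 3) * (α - 3) ^ 2) := by
  simp [a4, q4_eq_discriminant_mul, map_ofNat]

theorem aeval_a3 (α : ℂ) :
    aeval α a3 = α ^ 3 * (-(1020 * α) - 10064 * α ^ 2 + 5256 * α ^ 3 - 608 * α ^ 4 + 4 * α ^ 5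
      + 6 * ((1 - 57 * α - 289 * α ^ 2 + α ^ 3) * (α - 3) ^ 2)) := by
  simp [a3, q3, q4_eq_discriminant_mul, map_ofNat]

theorem aeval_derivative_a4 {α : ℂ} (hα : 1 - 57 * α - 289 * α ^ 2 + α ^ 3 = 0) :
    aeval α (derivative a4) = α ^ 4 * (α - 3) ^ 2 * (3 * α ^ 2 - 578 * α - 57) := by
  have h : derivative a4 =
      (1 - 57 * X - 289 * X ^ 2 + X ^ 3) * derivative (X ^ 4 * (X - 3) ^ 2)
        + X ^ 4 * (X - 3) ^ 2 * (3 * X ^ 2 - 578 * X - 57) := by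
    rw [a4, q4_eq_discriminant_mul]
    simp [derivative_pow, map_ofNat]
    ring
  simp [h, hα, map_ofNat]

theorem derivative_discriminant_ne_zero {α : ℂ} (hα : 1 - 57 * α - 289 * α ^ 2 + α ^ 3 = 0) :
    3 * α ^ 2 - 578 * α - 57 ≠ 0 := by
  intro h
  have : (1 : ℂ) = 0 := by
    linear_combination ((8819/33614) + (-183/134456) * α) * hα + ((-435/33614) + (-17635/134456) * α + (61/134456) * α ^ 2) * h
  exact one_ne_zero this

/-- At every conifold point `α` (root of the discriminant `1 − 57x − 289x² + x³`) one has
`a₄(α) = 0`, `a₄′(α) ≠ 0`, `a₃(α) = 2a₄′(α)`, and the indicial polynomial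
`I_α(ρ) = a₄′(α)·ρ(ρ−1)(ρ−2)(ρ−3) + a₃(α)·ρ(ρ−1)(ρ−2)` equals
`a₄′(α)·ρ(ρ−1)²(ρ−2)`: the local exponents of the Picard–Fuchs operator at each conifold
point are `0, 1, 1, 2`. -/
theorem stmt13 (α : ℂ) (hα : 1 - 57 * α - 289 * α ^ 2 + α ^ 3 = 0) :
    Polynomial.aeval α a4 = 0 ∧
    Polynomial.aeval α (derivative a4) ≠ 0 ∧
    Polynomial.aeval α a3 = 2 * Polynomial.aeval α (derivative a4) ∧
    C (Polynomial.aeval α (derivative a4)) * (X * (X - 1) * (X - 2) * (X - 3))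
        + C (Polynomial.aeval α a3) * (X * (X - 1) * (X - 2))
      = C (Polynomial.aeval α (derivative a4)) * ((X : Polynomial ℂ) * (X - 1) ^ 2 * (X - 2)) :=
  by
  have hd := aeval_derivative_a4 hα
  have h3 : aeval α a3 = 2 * aeval α (derivative a4) := by
    rw [hd, aeval_a3]
    linear_combination (α ^ 3 * (6 * (α - 3) ^ 2 - 2 * α ^ 2 + 6 * α)) * hα
  refine ⟨by rw [aeval_a4, hα]; ring, ?_, h3, ?_⟩
  · rw [hd]
    refine mul_ne_zero (mul_ne_zero (pow_ne_zero _ ?_) (pow_ne_zero _ (sub_ne_zero.2 ?_)))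
      (derivative_discriminant_ne_zero hα)
    · rintro rfl
      norm_num at hα
    · rintro rfl
      norm_num at hα
  · rw [h3, C_mul, map_ofNat]
    ring
end

section
/- For each k ∈ {0,…,6}, the determinant of the 6×6 matrix obtained from S by deleting its k-th row and k-th column equals p_k² in ℚ[y, u₀, …, u₆]; that is, each p_k is the Pfaffian of the corresponding principal 6×6 skew-symmetric minor of S. -/
/-- The polynomial ring `ℚ[y, u₀, …, u₆]`. -/
noncomputable abbrev R8 : Type := MvPolynomial (Fin 8) ℚ

/-- The variable `y`. -/
noncomputable def y : R8 := MvPolynomial.X 0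

/-- The variables `u₀, …, u₆`. -/
noncomputable def u (i : Fin 7) : R8 := MvPolynomial.X i.succ

/-- The `7×7` skew-symmetric matrix `S(y)` of the special Pfaffian Calabi–Yau family
`X′_{[1,y,0]}`. -/
noncomputable def Smat : Matrix (Fin 7) (Fin 7) R8 :=
  Matrix.of
    ![![0, -u 3, -(y * u 4), 0, 0, y * u 0, u 1],
      ![u 3, 0, -u 5, -(y * u 6), 0, 0, y * u 2],
      ![y * u 4, u 5, 0, -u 0, -(y * u 1), 0, 0],
      ![0, y * u 6, u 0, 0, -u 2, -(y * u 3), 0],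
      ![0, 0, y * u 1, u 2, 0, -u 4, -(y * u 5)],
      ![-(y * u 0), 0, 0, y * u 3, u 4, 0, -u 6],
      ![-u 1, -(y * u 2), 0, 0, y * u 5, u 6, 0]]

/-- The seven Pfaffians `p₀, …, p₆` of the principal `6×6` minors of `S`. -/
noncomputable def pv : Fin 7 → R8 :=
  ![y ^ 3 * (u 1 * u 2 * u 3) - y ^ 2 * (u 3 * u 5 ^ 2 + u 1 * u 6 ^ 2)
      - y * (u 0 * u 2 * u 4) + u 2 * u 5 * u 6,
    y ^ 3 * (u 3 * u 4 * u 5) - y ^ 2 * (u 5 * u 0 ^ 2 + u 3 * u 1 ^ 2)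
      - y * (u 2 * u 4 * u 6) + u 0 * u 1 * u 4,
    y ^ 3 * (u 0 * u 5 * u 6) - y ^ 2 * (u 5 * u 3 ^ 2 + u 0 * u 2 ^ 2)
      - y * (u 1 * u 4 * u 6) + u 2 * u 3 * u 6,
    y ^ 3 * (u 0 * u 1 * u 2) - y ^ 2 * (u 2 * u 4 ^ 2 + u 0 * u 5 ^ 2)
      - y * (u 1 * u 3 * u 6) + u 1 * u 4 * u 5,
    y ^ 3 * (u 2 * u 3 * u 4) - y ^ 2 * (u 2 * u 0 ^ 2 + u 4 * u 6 ^ 2)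
      - y * (u 1 * u 3 * u 5) + u 0 * u 3 * u 6,
    y ^ 3 * (u 4 * u 5 * u 6) - y ^ 2 * (u 6 * u 1 ^ 2 + u 4 * u 2 ^ 2)
      - y * (u 0 * u 3 * u 5) + u 1 * u 2 * u 5,
    y ^ 3 * (u 0 * u 1 * u 6) - y ^ 2 * (u 1 * u 3 ^ 2 + u 6 * u 4 ^ 2)
      - y * (u 0 * u 2 * u 5) + u 0 * u 3 * u 4]

/-- The determinant of a `6 × 6` alternating matrix is the square of its Pfaffian. -/
theorem Matrix.det_alternating_fin_six {R : Type*} [CommRing R]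
    (a b c d e f g h i j k l m n o : R) :
    !![0, a, b, c, d, e;
       -a, 0, f, g, h, i;
       -b, -f, 0, j, k, l;
       -c, -g, -j, 0, m, n;
       -d, -h, -k, -m, 0, o;
       -e, -i, -l, -n, -o, 0].det =
      (a * (j * o - k * n + l * m) - b * (g * o - h * n + i * m) + c * (f * o - h * l + i * k)
        - d * (f * n - g * l + i * j) + e * (f * m - g * k + h * j)) ^ 2 := by
  simp [Matrix.det_succ_row_zero, Fin.sum_univ_succ, Fin.succAbove]
  ring

/-- The determinant of a `6 × 6` alternating matrix, with its Pfaffian written in terms of the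
matrix entries. -/
theorem Matrix.det_eq_sq_of_alternating_fin_six {R : Type*} [CommRing R]
    (M : Matrix (Fin 6) (Fin 6) R) (hdiag : ∀ i, M i i = 0) (hskew : ∀ i j, M j i = -M i j) :
    M.det =
      (M 0 1 * (M 2 3 * M 4 5 - M 2 4 * M 3 5 + M 2 5 * M 3 4)
        - M 0 2 * (M 1 3 * M 4 5 - M 1 4 * M 3 5 + M 1 5 * M 3 4)
        + M 0 3 * (M 1 2 * M 4 5 - M 1 4 * M 2 5 + M 1 5 * M 2 4)
        - M 0 4 * (M 1 2 * M 3 5 - M 1 3 * M 2 5 + M 1 5 * M 2 3)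
        + M 0 5 * (M 1 2 * M 3 4 - M 1 3 * M 2 4 + M 1 4 * M 2 3)) ^ 2 := by
  rw [← Matrix.det_alternating_fin_six]
  congr 1
  ext i j
  fin_cases i <;> fin_cases j <;> first | exact hdiag _ | rfl | exact hskew _ _

theorem Smat_diag (i : Fin 7) : Smat i i = 0 := by
  fin_cases i <;> rfl

theorem Smat_skew (i j : Fin 7) : Smat j i = -Smat i j := by
  fin_cases i <;> fin_cases j <;> simp [Smat]

/-- Each `p_k` is the Pfaffian of the principal `6×6` skew-symmetric minor of `S` obtained by
deleting the `k`-th row and `k`-th column: `det(S with row k and column k deleted) = p_k²`. -/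
theorem stmt19 :
    ∀ k : Fin 7, (Smat.submatrix k.succAbove k.succAbove).det = pv k ^ 2 := by
  intro k
  rw [Matrix.det_eq_sq_of_alternating_fin_six (Smat.submatrix k.succAbove k.succAbove)
    (fun _ => Smat_diag _) (fun _ _ => Smat_skew _ _)]
  fin_cases k <;> simp [Smat, pv, Fin.succAbove] <;> ring
end
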